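/- arXiv:math/9308206 — 3 statements merged into one kernel-verified Lean document; each statement's English description precedes it below -/
import Mathlib

section
/- There is a constant C (one may take C = 16) such that for all 1 < p, q < ∞ and every sequence (k_n) of positive integers with limsup_n k_n = ∞, the spaces ℓ_p(ℓ_q^n) and ℓ_p(ℓ_q^{k_n}) are C-isomorphic: there exists a linear isomorphism Φ from ℓ_p(ℓ_q^n) onto ℓ_p(ℓ_q^{k_n}) with ‖Φ‖·‖Φ⁻¹‖ ≤ C. -/
open scoped ENNReal NNReal

noncomputable section

/-- `E` and `F` admit a linear homeomorphism `Φ` with `‖Φ x‖ ≤ C * ‖x‖` and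
`‖Φ.symm y‖ ≤ D * ‖y‖`. -/
def IsomorphicWith (𝕜 E F : Type*) [NontriviallyNormedField 𝕜] [NormedAddCommGroup E]
    [NormedSpace 𝕜 E] [NormedAddCommGroup F] [NormedSpace 𝕜 F] (C D : ℝ) : Prop :=
  ∃ Φ : E ≃L[𝕜] F, (∀ x, ‖Φ x‖ ≤ C * ‖x‖) ∧ ∀ y, ‖Φ.symm y‖ ≤ D * ‖y‖

namespace IsomorphicWith

variable {𝕜 E F G : Type*} [NontriviallyNormedField 𝕜] [NormedAddCommGroup E]
  [NormedSpace 𝕜 E] [NormedAddCommGroup F] [NormedSpace 𝕜 F] [NormedAddCommGroup G]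
  [NormedSpace 𝕜 G] {C C' D D' : ℝ}

theorem symm (h : IsomorphicWith 𝕜 E F C D) : IsomorphicWith 𝕜 F E D C := by
  obtain ⟨Φ, h₁, h₂⟩ := h
  exact ⟨Φ.symm, h₂, h₁⟩

theorem trans (hC' : 0 ≤ C') (hD : 0 ≤ D) (h : IsomorphicWith 𝕜 E F C D)
    (h' : IsomorphicWith 𝕜 F G C' D') : IsomorphicWith 𝕜 E G (C' * C) (D * D') := by
  obtain ⟨Φ, h₁, h₂⟩ := h
  obtain ⟨Ψ, h₃, h₄⟩ := h'
  refine ⟨Φ.trans Ψ, fun x => ?_, fun y => ?_⟩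
  · calc ‖Ψ (Φ x)‖ ≤ C' * ‖Φ x‖ := h₃ _
      _ ≤ C' * (C * ‖x‖) := by gcongr; exact h₁ x
      _ = C' * C * ‖x‖ := by ring
  · calc ‖Φ.symm (Ψ.symm y)‖ ≤ D * ‖Ψ.symm y‖ := h₂ _
      _ ≤ D * (D' * ‖y‖) := by gcongr; exact h₄ y
      _ = D * D' * ‖y‖ := by ring

end IsomorphicWith

section lp

variable {ι κ : Type*} {E : ι → Type*} {F : κ → Type*} [∀ i, NormedAddCommGroup (E i)]
  [∀ j, NormedAddCommGroup (F j)] {p : ℝ≥0∞}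

theorem memℓp_iff_tsum_enorm_ne_top (hp : 0 < p.toReal) (x : ∀ i, E i) :
    Memℓp x p ↔ ∑' i, ‖x i‖ₑ ^ p.toReal ≠ ∞ := by
  rw [memℓp_gen_iff hp]
  have h : ∀ i, ‖x i‖ₑ ^ p.toReal = ((‖x i‖₊ ^ p.toReal : ℝ≥0) : ℝ≥0∞) := fun i => by
    rw [enorm_eq_nnnorm, ENNReal.coe_rpow_of_nonneg _ hp.le]
  simp_rw [h]
  rw [ENNReal.tsum_coe_ne_top_iff_summable, ← NNReal.summable_coe]
  simp

theorem lp_enorm_rpow_eq_tsum [Fact (1 ≤ p)] (hp : 0 < p.toReal) (x : lp E p) :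
    ‖x‖ₑ ^ p.toReal = ∑' i, ‖x i‖ₑ ^ p.toReal := by
  have hs : Summable fun i => ‖x i‖ ^ p.toReal := (memℓp_gen_iff hp).1 (lp.memℓp x)
  have h := congrArg ENNReal.ofReal (lp.norm_rpow_eq_tsum hp x)
  rw [ENNReal.ofReal_tsum_of_nonneg (fun i => by positivity) hs] at h
  simpa [← ENNReal.ofReal_rpow_of_nonneg (norm_nonneg _) hp.le] using h

variable {𝕜 : Type*} [NontriviallyNormedField 𝕜] [∀ i, NormedSpace 𝕜 (E i)]
  [∀ j, NormedSpace 𝕜 (F j)]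

theorem memℓp_of_tsum_enorm_le (hp : 0 < p.toReal) {C : ℝ≥0} {x : ∀ i, E i} {y : ∀ j, F j}
    (h : ∑' j, ‖y j‖ₑ ^ p.toReal ≤ (C : ℝ≥0∞) ^ p.toReal * ∑' i, ‖x i‖ₑ ^ p.toReal)
    (hx : Memℓp x p) : Memℓp y p := by
  rw [memℓp_iff_tsum_enorm_ne_top hp] at hx ⊢
  exact ne_top_of_le_ne_top
    (ENNReal.mul_ne_top (ENNReal.rpow_ne_top_of_nonneg hp.le ENNReal.coe_ne_top) hx) h

theorem lp_norm_le_of_tsum_enorm_le [Fact (1 ≤ p)] (hp : 0 < p.toReal) {C : ℝ≥0}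
    (x : lp E p) (y : lp F p)
    (h : ∑' j, ‖y j‖ₑ ^ p.toReal ≤ (C : ℝ≥0∞) ^ p.toReal * ∑' i, ‖x i‖ₑ ^ p.toReal) :
    ‖y‖ ≤ C * ‖x‖ := by
  rw [← lp_enorm_rpow_eq_tsum hp, ← lp_enorm_rpow_eq_tsum hp,
    ← ENNReal.mul_rpow_of_nonneg _ _ hp.le, ENNReal.rpow_le_rpow_iff hp] at h
  simp only [enorm_eq_nnnorm] at h
  exact_mod_cast h

/-- A linear equivalence of the full products that is bounded for the `ℓ_p`-norms in both
directions restricts to an isomorphism of the `ℓ_p`-direct sums. -/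
theorem isomorphicWith_lp_of_tsum_enorm_le [Fact (1 ≤ p)] (hp : 0 < p.toReal) {C D : ℝ≥0}
    (T : (∀ i, E i) ≃ₗ[𝕜] ∀ j, F j)
    (hT : ∀ x, ∑' j, ‖T x j‖ₑ ^ p.toReal ≤ (C : ℝ≥0∞) ^ p.toReal * ∑' i, ‖x i‖ₑ ^ p.toReal)
    (hT' : ∀ x, ∑' i, ‖x i‖ₑ ^ p.toReal ≤
      (D : ℝ≥0∞) ^ p.toReal * ∑' j, ‖T x j‖ₑ ^ p.toReal) :
    IsomorphicWith 𝕜 (lp E p) (lp F p) C D := by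
  have hS : ∀ y, ∑' i, ‖T.symm y i‖ₑ ^ p.toReal ≤
      (D : ℝ≥0∞) ^ p.toReal * ∑' j, ‖y j‖ₑ ^ p.toReal := fun y => by
    simpa using hT' (T.symm y)
  let L : lp E p ≃ₗ[𝕜] lp F p :=
    { toFun := fun x => ⟨T x, memℓp_of_tsum_enorm_le hp (hT x) (lp.memℓp x)⟩
      invFun := fun y => ⟨T.symm y, memℓp_of_tsum_enorm_le hp (hS y) (lp.memℓp y)⟩
      map_add' := fun x y => Subtype.ext (map_add T x.1 y.1)
      map_smul' := fun c x => Subtype.ext (map_smul T c x.1)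
      left_inv := fun x => Subtype.ext (T.symm_apply_apply x.1)
      right_inv := fun y => Subtype.ext (T.apply_symm_apply y.1) }
  have hL : ∀ x, ‖L x‖ ≤ C * ‖x‖ := fun x => lp_norm_le_of_tsum_enorm_le hp x (L x) (hT x)
  have hL' : ∀ y, ‖L.symm y‖ ≤ D * ‖y‖ := fun y =>
    lp_norm_le_of_tsum_enorm_le hp y (L.symm y) (hS y)
  exact ⟨L.toContinuousLinearEquivOfBounds C D hL hL', hL, hL'⟩

theorem isomorphicWith_lp_comp_equiv [Fact (1 ≤ p)] (hp : 0 < p.toReal) (e : ι ≃ κ) :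
    IsomorphicWith 𝕜 (lp (fun i => F (e i)) p) (lp F p) 1 1 := by
  have h : ∀ x : ∀ i, F (e i), ∑' j, ‖LinearEquiv.piCongrLeft 𝕜 F e x j‖ₑ ^ p.toReal =
      ∑' i, ‖x i‖ₑ ^ p.toReal := fun x => by
    rw [← e.tsum_eq]
    refine tsum_congr fun i => ?_
    congr 2
    exact Equiv.piCongrLeft_apply_apply F e x i
  have := isomorphicWith_lp_of_tsum_enorm_le (𝕜 := 𝕜) hp (C := 1) (D := 1)
    (LinearEquiv.piCongrLeft 𝕜 F e) (fun x => by simp [h x]) (fun x => by simp [h x])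
  simpa using this

end lp

section split

theorem ENNReal.rpow_add_rpow_le_of_rpow_eq_add {a b c : ℝ≥0∞} {q r : ℝ} (hq : 1 ≤ q)
    (hr : 1 ≤ r) (h : c ^ q = a ^ q + b ^ q) : a ^ r + b ^ r ≤ 2 ^ r * c ^ r := by
  have hq₀ : 0 < q := by linarith
  have hr₀ : 0 ≤ r := by linarith
  have ha : a ≤ c := (ENNReal.rpow_le_rpow_iff hq₀).1 (h ▸ le_self_add)
  have hb : b ≤ c := (ENNReal.rpow_le_rpow_iff hq₀).1 (h ▸ le_add_self)
  calc a ^ r + b ^ r ≤ c ^ r + c ^ r := by gcongr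
    _ = 2 ^ (1 : ℝ) * c ^ r := by rw [ENNReal.rpow_one, two_mul]
    _ ≤ 2 ^ r * c ^ r := by
      gcongr
      exact one_le_two

theorem ENNReal.rpow_le_rpow_add_rpow_of_rpow_eq_add {a b c : ℝ≥0∞} {q r : ℝ} (hq : 1 ≤ q)
    (hr : 0 ≤ r) (h : c ^ q = a ^ q + b ^ q) : c ^ r ≤ 2 ^ r * (a ^ r + b ^ r) := by
  have hq₀ : 0 < q := by linarith
  have hc : c ≤ 2 * max a b := by
    refine (ENNReal.rpow_le_rpow_iff hq₀).1 ?_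
    calc c ^ q ≤ (a + b) ^ q := h ▸ ENNReal.add_rpow_le_rpow_add a b hq
      _ ≤ (2 * max a b) ^ q := by
        rw [two_mul]
        gcongr
        exacts [le_max_left _ _, le_max_right _ _]
  calc c ^ r ≤ (2 * max a b) ^ r := by gcongr
    _ = 2 ^ r * max a b ^ r := ENNReal.mul_rpow_of_nonneg _ _ hr
    _ ≤ 2 ^ r * (a ^ r + b ^ r) := by
      gcongr
      rcases max_choice a b with h | h <;> rw [h]
      exacts [le_self_add, le_add_self]

theorem PiLp.enorm_rpow_eq_sum {α : Type*} [Fintype α] {β : α → Type*}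
    [∀ a, NormedAddCommGroup (β a)] {q : ℝ≥0∞} [Fact (1 ≤ q)] (hq : 0 < q.toReal)
    (x : PiLp q β) : ‖x‖ₑ ^ q.toReal = ∑ a, ‖x a‖ₑ ^ q.toReal := by
  have hq' : q ≠ ∞ := fun h => by simp [h] at hq
  have h := PiLp.nnnorm_eq_sum hq' x
  simp only [enorm_eq_nnnorm, ← ENNReal.coe_rpow_of_nonneg _ hq.le]
  rw [h, ← NNReal.rpow_mul, one_div_mul_cancel hq.ne', NNReal.rpow_one]
  push_cast
  rfl

variable {𝕜 ι : Type*} [NontriviallyNormedField 𝕜] {A : ι → Type*} {B : ι ⊕ ι → Type*}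

/-- Cutting every coordinate block `A n` into the two blocks `B (inl n)` and `B (inr n)`. -/
def piLpSplit (𝕜 : Type*) [NontriviallyNormedField 𝕜] (q : ℝ≥0∞)
    (σ : ∀ n, B (.inl n) ⊕ B (.inr n) ≃ A n) :
    (∀ n, PiLp q fun _ : A n => 𝕜) ≃ₗ[𝕜] ∀ i, PiLp q fun _ : B i => 𝕜 where
  toFun x i := match i with
    | .inl n => WithLp.toLp q fun b => x n (σ n (.inl b))
    | .inr n => WithLp.toLp q fun b => x n (σ n (.inr b))
  invFun y n := WithLp.toLp q fun a => Sum.elim (y (.inl n)) (y (.inr n)) ((σ n).symm a)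
  map_add' x y := by ext (n | n) b <;> rfl
  map_smul' c x := by ext (n | n) b <;> rfl
  left_inv x := by
    ext n a
    obtain ⟨b | b, rfl⟩ := (σ n).surjective a <;> simp
  right_inv y := by ext (n | n) b <;> simp

theorem isomorphicWith_lp_split [∀ n, Fintype (A n)] [∀ i, Fintype (B i)] {p q : ℝ≥0∞}
    [Fact (1 ≤ p)] [Fact (1 ≤ q)] (hp : p ≠ ∞) (hq : q ≠ ∞)
    (σ : ∀ n, B (.inl n) ⊕ B (.inr n) ≃ A n) :
    IsomorphicWith 𝕜 (lp (fun n => PiLp q fun _ : A n => 𝕜) p)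
      (lp (fun i => PiLp q fun _ : B i => 𝕜) p) 2 2 := by
  have hp₁ : 1 ≤ p.toReal := by
    simpa using ENNReal.toReal_mono hp (Fact.out : 1 ≤ p)
  have hq₁ : 1 ≤ q.toReal := by
    simpa using ENNReal.toReal_mono hq (Fact.out : 1 ≤ q)
  have hsplit : ∀ (x : ∀ n, PiLp q fun _ : A n => 𝕜) n, ‖x n‖ₑ ^ q.toReal =
      ‖piLpSplit 𝕜 q σ x (.inl n)‖ₑ ^ q.toReal +
        ‖piLpSplit 𝕜 q σ x (.inr n)‖ₑ ^ q.toReal := fun x n => by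
    have hq₀ : 0 < q.toReal := by linarith
    simp only [PiLp.enorm_rpow_eq_sum hq₀]
    rw [← (σ n).sum_comp, Fintype.sum_sum_type]
    rfl
  have hsum : ∀ x : ∀ n, PiLp q fun _ : A n => 𝕜,
      ∑' i, ‖piLpSplit 𝕜 q σ x i‖ₑ ^ p.toReal =
        ∑' n, (‖piLpSplit 𝕜 q σ x (.inl n)‖ₑ ^ p.toReal +
          ‖piLpSplit 𝕜 q σ x (.inr n)‖ₑ ^ p.toReal) := fun x => by
    rw [ENNReal.tsum_add]
    exact ENNReal.summable.tsum_sum ENNReal.summable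
  have := isomorphicWith_lp_of_tsum_enorm_le (𝕜 := 𝕜) (p := p) (by linarith) (C := 2) (D := 2)
    (piLpSplit 𝕜 q σ)
    (fun x => by
      rw [hsum, ← ENNReal.tsum_mul_left]
      exact ENNReal.tsum_le_tsum fun n =>
        ENNReal.rpow_add_rpow_le_of_rpow_eq_add hq₁ hp₁ (hsplit x n))
    (fun x => by
      rw [hsum, ← ENNReal.tsum_mul_left]
      exact ENNReal.tsum_le_tsum fun n =>
        ENNReal.rpow_le_rpow_add_rpow_of_rpow_eq_add hq₁ (by linarith) (hsplit x n))
  simpa using this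

end split

section combinatorics

/-- Below an unbounded sequence lies one taking each value infinitely often. -/
theorem exists_le_infinite_fibers {k : ℕ → ℕ} (hk : ∀ m, ∃ n, m ≤ k n) :
    ∃ d : ℕ → ℕ, (∀ n, d n ≤ k n) ∧ ∀ m, {n | d n = m}.Infinite := by
  have hfreq : ∀ m, ∃ᶠ n in Filter.atTop, m ≤ k n := fun m => by
    rw [Filter.frequently_atTop]
    intro N
    obtain ⟨n, hn⟩ := hk (max m ((Finset.range N).sup k + 1))
    refine ⟨n, ?_, le_trans (le_max_left _ _) hn⟩
    by_contra! hlt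
    have := Finset.le_sup (f := k) (Finset.mem_range.2 hlt)
    have := le_trans (le_max_right _ _) hn
    omega
  obtain ⟨φ, hφ, hφk⟩ := Filter.extraction_forall_of_frequently hfreq
  refine ⟨Function.extend φ (fun j => j.unpair.1) 0, fun n => ?_, fun m => ?_⟩
  · by_cases hn : ∃ j, φ j = n
    · obtain ⟨j, rfl⟩ := hn
      rw [hφ.injective.extend_apply]
      exact (Nat.unpair_left_le j).trans (hφk j)
    · rw [Function.extend_apply' _ _ _ hn]
      exact Nat.zero_le _
  · refine Set.infinite_of_injective_forall_mem (f := fun i => φ (Nat.pair m i))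
      (fun i j hij => ?_) fun i => ?_
    · simpa using hφ.injective hij
    · simp [hφ.injective.extend_apply]

theorem exists_equiv_comp_eq_of_infinite_fibers {α β γ : Type*} [Countable α] [Countable β]
    {s : α → γ} {t : β → γ} (hs : ∀ c, {a | s a = c}.Infinite)
    (ht : ∀ c, {b | t b = c}.Infinite) : ∃ e : α ≃ β, ∀ a, t (e a) = s a := by
  have h : ∀ c, Nonempty ({a // s a = c} ≃ {b // t b = c}) := fun c => by
    have : Infinite {a // s a = c} := (hs c).to_subtype
    have : Infinite {b // t b = c} := (ht c).to_subtype
    exact nonempty_equiv_of_countable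
  exact ⟨Equiv.ofFiberEquiv fun c => (h c).some, fun a => Equiv.ofFiberEquiv_map _ a⟩

end combinatorics

/-- Up to a constant, `ℓ_p(ℓ_q^{k_n})` for unbounded `k` is an `ℓ_p`-direct sum in which each
`ℓ_q^m` occurs infinitely often. -/
theorem exists_isomorphicWith_lp_infinite_fibers (𝕜 : Type*) [NontriviallyNormedField 𝕜]
    {p q : ℝ≥0∞} [Fact (1 ≤ p)] [Fact (1 ≤ q)] (hp : p ≠ ∞) (hq : q ≠ ∞) {k : ℕ → ℕ}
    (hk : ∀ m, ∃ n, m ≤ k n) :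
    ∃ s : ℕ ⊕ ℕ → ℕ, (∀ m, {i | s i = m}.Infinite) ∧
      IsomorphicWith 𝕜 (lp (fun n => PiLp q fun _ : Fin (k n) => 𝕜) p)
        (lp (fun i => PiLp q fun _ : Fin (s i) => 𝕜) p) 2 2 := by
  obtain ⟨d, hdk, hd⟩ := exists_le_infinite_fibers hk
  refine ⟨Sum.elim d fun n => k n - d n, fun m => ?_, ?_⟩
  · refine ((hd m).image Sum.inl_injective.injOn).mono ?_
    rintro _ ⟨n, hn, rfl⟩
    exact hn
  · exact isomorphicWith_lp_split (B := fun i => Fin (Sum.elim d (fun n => k n - d n) i)) hp hq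
      fun n => finSumFinEquiv.trans (finCongr (Nat.add_sub_of_le (hdk n)))

set_option synthInstance.maxHeartbeats 1000000 in
set_option maxHeartbeats 2000000 in
/-- There is a constant `C` (one may take `C = 16`) such that for all `1 < p, q < ∞` and every
unbounded sequence `(k_n)` of positive integers, `ℓ_p(ℓ_q^n)` is `C`-isomorphic to
`ℓ_p(ℓ_q^{k_n})`. -/
theorem lpLqn_C_isomorphic_subsequence :
    ∃ C : ℝ, ∀ (p q : ℝ≥0∞) [Fact (1 ≤ p)] [Fact (1 ≤ q)],
      1 < p → p ≠ ∞ → 1 < q → q ≠ ∞ →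
      ∀ k : ℕ → ℕ, (∀ n, 0 < k n) → (∀ m : ℕ, ∃ n, m ≤ k n) →
      ∃ Φ : lp (fun n : ℕ => PiLp q (fun _ : Fin (n + 1) => ℂ)) p ≃L[ℂ]
            lp (fun n : ℕ => PiLp q (fun _ : Fin (k n) => ℂ)) p,
        ‖(Φ : lp (fun n : ℕ => PiLp q (fun _ : Fin (n + 1) => ℂ)) p →L[ℂ]
              lp (fun n : ℕ => PiLp q (fun _ : Fin (k n) => ℂ)) p)‖ *
        ‖(Φ.symm : lp (fun n : ℕ => PiLp q (fun _ : Fin (k n) => ℂ)) p →L[ℂ]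
              lp (fun n : ℕ => PiLp q (fun _ : Fin (n + 1) => ℂ)) p)‖ ≤ C := by
  refine ⟨16, fun p q _ _ _ hp _ hq k _ hk => ?_⟩
  obtain ⟨s, hs, hXs⟩ := exists_isomorphicWith_lp_infinite_fibers ℂ (p := p) (q := q) hp hq
    (k := fun n => n + 1) fun m => ⟨m, m.le_succ⟩
  obtain ⟨t, ht, hYt⟩ := exists_isomorphicWith_lp_infinite_fibers ℂ (p := p) (q := q) hp hq hk
  obtain ⟨e, he⟩ := exists_equiv_comp_eq_of_infinite_fibers hs ht
  obtain rfl : s = fun i => t (e i) := funext fun i => (he i).symm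
  have hp₀ : 0 < p.toReal :=
    ENNReal.toReal_pos (zero_lt_one.trans_le (Fact.out : 1 ≤ p)).ne' hp
  have hst := isomorphicWith_lp_comp_equiv (𝕜 := ℂ) (F := fun j => PiLp q fun _ : Fin (t j) => ℂ)
    hp₀ e
  obtain ⟨Φ, h₁, h₂⟩ := (hXs.trans zero_le_one zero_le_two hst).trans zero_le_two
    (by norm_num) hYt.symm
  refine ⟨Φ, ?_⟩
  calc _ ≤ (2 * (1 * 2) : ℝ) * (2 * 1 * 2) :=
        mul_le_mul (ContinuousLinearMap.opNorm_le_bound _ (by norm_num) h₁)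
          (ContinuousLinearMap.opNorm_le_bound _ (by norm_num) h₂) (norm_nonneg _) (by norm_num)
    _ = 16 := by norm_num
end
end

section
/- Let 1 < p < ∞ and let (E_n) be a sequence of finite-dimensional Banach spaces. Let X = ℓ_p(E_n) and for each k let P_k ∈ 𝓛(X) denote the canonical projection onto the k-th coordinate block (P_k x has k-th coordinate x_k and all other coordinates 0). Suppose T ∈ 𝓛(X) satisfies sup_k ‖P_k T P_k‖ ≤ ε for some ε > 0. Then there is a strictly increasing sequence (k_n) of positive integers such that ‖P T P‖ ≤ 3ε, where P ∈ 𝓛(X) is the canonical projection onto the coordinates belonging to {k_1, k_2, …} (i.e., (P x)_m = x_m if m ∈ {k_n : n ≥ 1} and (P x)_m = 0 otherwise). -/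
open scoped ENNReal NNReal Classical

noncomputable section

open Filter Topology

namespace lp

section Bounds

variable {p : ℝ≥0∞} {E : ℕ → Type*} [∀ n, NormedAddCommGroup (E n)]

theorem norm_sum_single_le [Fact (1 ≤ p)] (hp : 0 < p.toReal) {C : ℝ} (hC : 0 ≤ C) (x : lp E p)
    (v : ∀ i, E i) (s : Finset ℕ) (hv : ∀ i ∈ s, ‖v i‖ ≤ C * ‖x i‖) :
    ‖∑ i ∈ s, lp.single p i (v i)‖ ≤ C * ‖x‖ := by
  rw [← Real.rpow_le_rpow_iff (norm_nonneg _) (by positivity) hp, lp.norm_sum_single hp,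
    Real.mul_rpow hC (norm_nonneg _)]
  calc ∑ i ∈ s, ‖v i‖ ^ p.toReal
      ≤ ∑ i ∈ s, C ^ p.toReal * ‖x i‖ ^ p.toReal := by
        refine Finset.sum_le_sum fun i hi => ?_
        rw [← Real.mul_rpow hC (norm_nonneg _)]
        exact Real.rpow_le_rpow (norm_nonneg _) (hv i hi) hp.le
    _ ≤ C ^ p.toReal * ‖x‖ ^ p.toReal := by
        rw [← Finset.mul_sum]
        gcongr
        exact lp.sum_rpow_le_norm_rpow hp x s

theorem norm_sum_single_le_card_rpow [Fact (1 ≤ p)] (hp : 0 < p.toReal) (v : ∀ i, E i)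
    (hv : ∀ i, ‖v i‖ ≤ 1) (s : Finset ℕ) :
    ‖∑ i ∈ s, lp.single p i (v i)‖ ≤ (s.card : ℝ) ^ (p.toReal)⁻¹ := by
  rw [Real.le_rpow_inv_iff_of_pos (norm_nonneg _) (by positivity) hp, lp.norm_sum_single hp]
  calc ∑ i ∈ s, ‖v i‖ ^ p.toReal ≤ ∑ _i ∈ s, (1 : ℝ) :=
        Finset.sum_le_sum fun i _ => Real.rpow_le_one (norm_nonneg _) (hv i) hp.le
    _ = s.card := by simp

theorem tendsto_norm_apply_zero (hp : 0 < p.toReal) (x : lp E p) :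
    Tendsto (fun i => ‖x i‖) atTop (𝓝 0) := by
  have h := ((lp.memℓp x).summable hp).tendsto_atTop_zero.rpow_const
    (Or.inr (inv_nonneg.2 hp.le))
  simpa [Real.rpow_rpow_inv (norm_nonneg _) hp.ne', Real.zero_rpow (inv_pos.2 hp).ne'] using h

theorem tendsto_sum_single_of_proj [Fact (1 ≤ p)] (hptop : p ≠ ∞) {k : ℕ → ℕ} (hk : StrictMono k)
    (x y : lp E p) (hy : ∀ l, y l = if l ∈ Set.range k then x l else 0) :
    Tendsto (fun n => ∑ j ∈ (Finset.range n).image k, lp.single p j (x j)) atTop (𝓝 y) := by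
  have h := lp.hasSum_single hptop y
  rw [← hk.injective.hasSum_iff fun l hl => by rw [hy, if_neg hl, lp.single_zero]] at h
  refine h.tendsto_sum_nat.congr fun n => ?_
  rw [Finset.sum_image hk.injective.injOn]
  refine Finset.sum_congr rfl fun j _ => ?_
  rw [Function.comp_apply, hy, if_pos ⟨j, rfl⟩]

end Bounds

variable {p : ℝ≥0∞} [Fact (1 ≤ p)] {E : ℕ → Type*} [∀ n, NormedAddCommGroup (E n)]
  [∀ n, NormedSpace ℂ (E n)] {F : Type*} [NormedAddCommGroup F] [NormedSpace ℂ F]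

@[simp]
theorem evalCLM_apply (i : ℕ) (x : lp E p) : lp.evalCLM ℂ E p i x = x i := rfl

/-- The restrictions to the coordinate blocks of an operator from `ℓ_p(E_n)`, `1 < p < ∞`, to a
finite-dimensional space tend to zero in norm. -/
theorem eventually_norm_comp_single_le [FiniteDimensional ℂ F] (hp1 : 1 < p) (hptop : p ≠ ∞)
    (R : lp E p →L[ℂ] F) {δ : ℝ} (hδ : 0 < δ) :
    ∀ᶠ j in atTop, ‖R ∘L lp.singleContinuousLinearMap ℂ E p j‖ ≤ δ := by
  have hpr : 1 < p.toReal := by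
    simpa using (ENNReal.toReal_lt_toReal ENNReal.one_ne_top hptop).2 hp1
  have hp0 : 0 < p.toReal := zero_lt_one.trans hpr
  by_contra hcon
  obtain ⟨φ, hφ, hbig⟩ := extraction_of_frequently_atTop (not_eventually.1 hcon)
  have hx : ∀ j, ∃ x : E j, ‖x‖ ≤ 1 ∧
      (δ < ‖R ∘L lp.singleContinuousLinearMap ℂ E p j‖ → δ < ‖R (lp.single p j x)‖) := by
    intro j
    by_cases h : δ < ‖R ∘L lp.singleContinuousLinearMap ℂ E p j‖
    · obtain ⟨x, hx1, hx⟩ := ContinuousLinearMap.exists_lt_apply_of_lt_opNorm _ h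
      exact ⟨x, hx1.le, fun _ => hx⟩
    · exact ⟨0, by simp, fun h' => absurd h' h⟩
  choose x hx1 hxδ using hx
  have : ProperSpace F := FiniteDimensional.proper ℂ F
  obtain ⟨y, -, ψ, hψ, hy⟩ := tendsto_subseq_of_bounded
    (x := fun n => R (lp.single p (φ n) (x (φ n)))) (Metric.isBounded_closedBall (x := 0) (r := ‖R‖))
    (fun n => by
      rw [mem_closedBall_zero_iff]
      refine R.le_of_opNorm_le_of_le le_rfl (b := 1) ?_ |>.trans_eq (mul_one _)
      rw [lp.norm_single (zero_lt_one.trans hp1)]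
      exact hx1 _)
  have hθ : StrictMono (φ ∘ ψ) := hφ.comp hψ
  have hyδ : δ ≤ ‖y‖ :=
    ge_of_tendsto' hy.norm fun n => (hxδ _ (not_le.1 (hbig (ψ n)))).le
  have hbound : ∀ n : ℕ, ‖((n : ℝ)⁻¹) • ∑ i ∈ Finset.range n,
      R (lp.single p ((φ ∘ ψ) i) (x ((φ ∘ ψ) i)))‖ ≤ ‖R‖ * (n : ℝ)⁻¹ * (n : ℝ) ^ (p.toReal)⁻¹ := by
    intro n
    have h := norm_sum_single_le_card_rpow hp0 x hx1 ((Finset.range n).image (φ ∘ ψ))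
    rw [Finset.sum_image hθ.injective.injOn, Finset.card_image_of_injective _ hθ.injective,
      Finset.card_range] at h
    rw [← map_sum, norm_smul, Real.norm_of_nonneg (by positivity)]
    calc (n : ℝ)⁻¹ * ‖R (∑ i ∈ Finset.range n, lp.single p ((φ ∘ ψ) i) (x ((φ ∘ ψ) i)))‖
        ≤ (n : ℝ)⁻¹ * (‖R‖ * (n : ℝ) ^ (p.toReal)⁻¹) := by
          gcongr
          exact R.le_of_opNorm_le_of_le le_rfl h
      _ = _ := by ring
  have hlim : Tendsto (fun n : ℕ => ‖R‖ * (n : ℝ)⁻¹ * (n : ℝ) ^ (p.toReal)⁻¹) atTop (𝓝 0) := by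
    have h := ((tendsto_rpow_neg_atTop (sub_pos.2 (inv_lt_one_of_one_lt₀ hpr))).comp
      tendsto_natCast_atTop_atTop).const_mul ‖R‖
    rw [mul_zero] at h
    refine h.congr' ?_
    filter_upwards [eventually_gt_atTop 0] with n hn
    have hn' : (0 : ℝ) < n := by exact_mod_cast hn
    rw [Function.comp_apply, mul_assoc, ← Real.rpow_neg_one (n : ℝ), ← Real.rpow_add hn']
    congr 2
    ring
  have hy0 : ‖y‖ ≤ 0 := le_of_tendsto_of_tendsto' hy.cesaro_smul.norm hlim hbound
  linarith

/-- The coordinates of an operator from a finite-dimensional space to `ℓ_p(E_n)`, `p < ∞`, tend to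
zero in norm. -/
theorem eventually_norm_eval_comp_le [FiniteDimensional ℂ F] (hp : 0 < p.toReal)
    (S : F →L[ℂ] lp E p) {δ : ℝ} (hδ : 0 < δ) :
    ∀ᶠ i in atTop, ‖lp.evalCLM ℂ E p i ∘L S‖ ≤ δ := by
  by_contra hcon
  obtain ⟨φ, hφ, hbig⟩ := extraction_of_frequently_atTop (not_eventually.1 hcon)
  choose x hx1 hxδ using fun n =>
    ContinuousLinearMap.exists_lt_apply_of_lt_opNorm _ (not_le.1 (hbig n))
  have : ProperSpace F := FiniteDimensional.proper ℂ F
  obtain ⟨y, -, ψ, hψ, hy⟩ := tendsto_subseq_of_bounded (x := x)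
    (Metric.isBounded_closedBall (x := 0) (r := 1))
    (fun n => mem_closedBall_zero_iff.2 (hx1 n).le)
  have hbound : ∀ n, δ ≤ ‖S ((x ∘ ψ) n - y)‖ + ‖S y (φ (ψ n))‖ := by
    intro n
    refine (hxδ (ψ n)).le.trans ?_
    have h := lp.norm_apply_le_norm (zero_lt_one.trans_le (Fact.out : 1 ≤ p)).ne'
      (S ((x ∘ ψ) n - y)) (φ (ψ n))
    have h' : S (x (ψ n)) (φ (ψ n)) = S ((x ∘ ψ) n - y) (φ (ψ n)) + S y (φ (ψ n)) := by
      rw [map_sub]; simp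
    change ‖S (x (ψ n)) (φ (ψ n))‖ ≤ _
    rw [h']
    exact (norm_add_le _ _).trans (by gcongr)
  have hlim : Tendsto (fun n => ‖S ((x ∘ ψ) n - y)‖ + ‖S y (φ (ψ n))‖) atTop (𝓝 0) := by
    have h1 : Tendsto (fun n => ‖S ((x ∘ ψ) n - y)‖) atTop (𝓝 0) := by
      have := ((S.continuous.tendsto _).comp (tendsto_sub_nhds_zero_iff.2 hy)).norm
      simpa using this
    have h2 := (tendsto_norm_apply_zero hp (S y)).comp (hφ.comp hψ).tendsto_atTop
    simpa using h1.add h2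
  exact absurd (ge_of_tendsto' hlim hbound) (not_le.2 hδ)

/-- The matrix entry `E j → E i` of an operator on `ℓ_p(E_n)`. -/
def entry (T : lp E p →L[ℂ] lp E p) (i j : ℕ) : E j →L[ℂ] E i :=
  lp.evalCLM ℂ E p i ∘L T ∘L lp.singleContinuousLinearMap ℂ E p j

theorem entry_apply (T : lp E p →L[ℂ] lp E p) (i j : ℕ) (v : E j) :
    entry T i j v = T (lp.single p j v) i := rfl

/-- A finite block of an operator on `ℓ_p(E_n)` is bounded by the supremum of its diagonal entries
plus the sum of its off-diagonal entries. -/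
theorem norm_finite_block_le (hp : 0 < p.toReal) (T : lp E p →L[ℂ] lp E p) {C D : ℝ} (hC : 0 ≤ C)
    (s : Finset ℕ) (hdiag : ∀ i ∈ s, ‖entry T i i‖ ≤ C)
    (hoff : ∑ i ∈ s, ∑ j ∈ s, (if i = j then 0 else ‖entry T i j‖) ≤ D) (x : lp E p) :
    ‖∑ i ∈ s, lp.single p i (T (∑ j ∈ s, lp.single p j (x j)) i)‖ ≤ (C + D) * ‖x‖ := by
  have hp0 : 0 < p := zero_lt_one.trans_le Fact.out
  have hsplit : ∀ i ∈ s, T (∑ j ∈ s, lp.single p j (x j)) i =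
      entry T i i (x i) + ∑ j ∈ s, (if i = j then 0 else entry T i j (x j)) := by
    intro i hi
    rw [map_sum, lp.coeFn_sum, Finset.sum_apply, ← Finset.add_sum_erase _ _ hi,
      ← Finset.add_sum_erase s (fun j => if i = j then 0 else entry T i j (x j)) hi, if_pos rfl,
      zero_add, entry_apply]
    congr 1
    refine Finset.sum_congr rfl fun j hj => ?_
    rw [if_neg (Finset.ne_of_mem_erase hj).symm, entry_apply]
  have hdiag' : ‖∑ i ∈ s, lp.single p i (entry T i i (x i))‖ ≤ C * ‖x‖ :=
    norm_sum_single_le hp hC x (fun i => entry T i i (x i)) s fun i hi =>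
      (entry T i i).le_of_opNorm_le (hdiag i hi) _
  have hoff' : ‖∑ i ∈ s, lp.single p i (∑ j ∈ s, (if i = j then 0 else entry T i j (x j)))‖
      ≤ D * ‖x‖ := by
    refine (norm_sum_le _ _).trans (le_trans ?_ (mul_le_mul_of_nonneg_right hoff (norm_nonneg x)))
    rw [Finset.sum_mul]
    refine Finset.sum_le_sum fun i _ => ?_
    rw [lp.norm_single hp0, Finset.sum_mul]
    refine (norm_sum_le _ _).trans (Finset.sum_le_sum fun j _ => ?_)
    split_ifs
    · simp
    · exact (entry T i j).le_of_opNorm_le_of_le le_rfl (lp.norm_apply_le_norm hp0.ne' x j)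
  rw [Finset.sum_congr rfl fun i hi => by rw [hsplit i hi, lp.single_add], Finset.sum_add_distrib,
    add_mul]
  exact (norm_add_le _ _).trans (add_le_add hdiag' hoff')

/-- There is a subsequence along which the off-diagonal entries are dominated by a summable
product. -/
theorem exists_strictMono_norm_entry_le [∀ n, FiniteDimensional ℂ (E n)] (hp1 : 1 < p)
    (hptop : p ≠ ∞) (T : lp E p →L[ℂ] lp E p) {ε : ℝ} (hε : 0 < ε) :
    ∃ k : ℕ → ℕ, StrictMono k ∧ ∀ i j, i ≠ j →
      ‖entry T (k i) (k j)‖ ≤ ε * ((1 / 2) ^ (i + 1) * (1 / 2) ^ (j + 1)) := by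
  have hp : 0 < p.toReal := ENNReal.toReal_pos (zero_lt_one.trans hp1).ne' hptop
  let r : ℕ × ℕ → ℕ × ℕ → Prop := fun a b => a.1 < b.1 ∧ a.2 < b.2 ∧
    ‖entry T a.2 b.2‖ ≤ ε * ((1 / 2) ^ (a.1 + 1) * (1 / 2) ^ (b.1 + 1)) ∧
    ‖entry T b.2 a.2‖ ≤ ε * ((1 / 2) ^ (a.1 + 1) * (1 / 2) ^ (b.1 + 1))
  obtain ⟨f, -, hf⟩ := exists_seq_of_forall_finset_exists (fun _ : ℕ × ℕ => True) r <| by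
    intro s _
    have h : ∀ᶠ b in atTop, ∀ a ∈ s, r a (s.sup Prod.fst + 1, b) := by
      refine (Finset.eventually_all s).2 fun a ha => ?_
      have hpos : 0 < ε * ((1 / 2) ^ (a.1 + 1) * (1 / 2) ^ (s.sup Prod.fst + 1 + 1)) := by
        positivity
      filter_upwards [eventually_gt_atTop a.2,
        eventually_norm_comp_single_le hp1 hptop (lp.evalCLM ℂ E p a.2 ∘L T) hpos,
        eventually_norm_eval_comp_le hp (T ∘L lp.singleContinuousLinearMap ℂ E p a.2) hpos]
        with b hb h1 h2
      exact ⟨Nat.lt_succ_of_le (Finset.le_sup (f := Prod.fst) ha), hb, h1, h2⟩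
    obtain ⟨b, hb⟩ := h.exists
    exact ⟨_, trivial, hb⟩
  have hid : ∀ n, n ≤ (f n).1 :=
    fun _ => StrictMono.le_apply (f := fun n => (f n).1) (fun m n hmn => (hf m n hmn).1)
  have hle : ∀ i j : ℕ, ε * ((1 / 2 : ℝ) ^ ((f i).1 + 1) * (1 / 2) ^ ((f j).1 + 1)) ≤
      ε * ((1 / 2) ^ (i + 1) * (1 / 2) ^ (j + 1)) := by
    intro i j
    gcongr ε * (?_ * ?_)
    · exact pow_le_pow_of_le_one (by norm_num) (by norm_num) (by simpa using hid i)
    · exact pow_le_pow_of_le_one (by norm_num) (by norm_num) (by simpa using hid j)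
  refine ⟨fun n => (f n).2, fun m n hmn => (hf m n hmn).2.1, fun i j hij => ?_⟩
  rcases lt_or_gt_of_ne hij with h | h
  · exact (hf i j h).2.2.1.trans (hle i j)
  · exact (hf j i h).2.2.2.trans ((hle j i).trans_eq (by ring))

/-- If the diagonal block `P_k T P_k` is bounded by `C`, so is the entry `T k k`. -/
theorem norm_entry_self_le (T : lp E p →L[ℂ] lp E p) {C : ℝ} (hC : 0 ≤ C) (k : ℕ)
    (hT : ∀ Pk : lp E p →L[ℂ] lp E p,
      (∀ (x : lp E p) (l : ℕ), Pk x l = if l = k then x l else 0) → ‖Pk ∘L T ∘L Pk‖ ≤ C) :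
    ‖entry T k k‖ ≤ C := by
  have hp0 : 0 < p := zero_lt_one.trans_le Fact.out
  have h := hT (lp.singleContinuousLinearMap ℂ E p k ∘L lp.evalCLM ℂ E p k) fun x l => by
    by_cases hl : l = k
    · subst hl; simp
    · simp [hl]
  refine ContinuousLinearMap.opNorm_le_bound _ hC fun v => ?_
  have := ContinuousLinearMap.le_of_opNorm_le _ h (lp.single p k v)
  simpa [lp.norm_single hp0, entry_apply] using this

end lp

/-- Let `1 < p < ∞`, let `(E_n)` be finite-dimensional Banach spaces and `P_k` the canonical
coordinate projections on `ℓ_p(E_n)`.  If `T ∈ 𝓛(ℓ_p(E_n))` satisfies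
`sup_k ‖P_k T P_k‖ ≤ ε`, then there is a strictly increasing sequence `(k_n)` such that
`‖P T P‖ ≤ 3ε` for the canonical projection `P` onto the coordinates in `{k_n : n}`. -/
theorem exists_subsequence_norm_proj_comp_le
    (p : ℝ≥0∞) [Fact (1 ≤ p)] (hp1 : 1 < p) (hptop : p ≠ ∞)
    (E : ℕ → Type*) [∀ n, NormedAddCommGroup (E n)] [∀ n, NormedSpace ℂ (E n)]
    [∀ n, FiniteDimensional ℂ (E n)]
    (T : lp E p →L[ℂ] lp E p) (ε : ℝ) (hε : 0 < ε)
    (hT : ∀ (k : ℕ) (Pk : lp E p →L[ℂ] lp E p),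
      (∀ (x : lp E p) (l : ℕ), Pk x l = if l = k then x l else 0) →
      ‖Pk ∘L T ∘L Pk‖ ≤ ε) :
    ∃ k : ℕ → ℕ, StrictMono k ∧
      ∀ P : lp E p →L[ℂ] lp E p,
        (∀ (x : lp E p) (l : ℕ), P x l = if l ∈ Set.range k then x l else 0) →
        ‖P ∘L T ∘L P‖ ≤ 3 * ε := by
  have hp : 0 < p.toReal := ENNReal.toReal_pos (zero_lt_one.trans hp1).ne' hptop
  obtain ⟨k, hk, hoff⟩ := lp.exists_strictMono_norm_entry_le hp1 hptop T hε
  refine ⟨k, hk, fun P hP => ContinuousLinearMap.opNorm_le_bound _ (by positivity) fun x => ?_⟩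
  have hgeom : ∀ n : ℕ, ∑ i ∈ Finset.range n, (1 / 2 : ℝ) ^ (i + 1) ≤ 1 := by
    intro n
    have h := sum_geometric_two_le n
    simp only [pow_succ, ← Finset.sum_mul]
    linarith
  have hsum : ∀ n : ℕ, ∑ i ∈ (Finset.range n).image k, ∑ j ∈ (Finset.range n).image k,
      (if i = j then 0 else ‖lp.entry T i j‖) ≤ 2 * ε := by
    intro n
    simp only [Finset.sum_image hk.injective.injOn]
    calc ∑ i ∈ Finset.range n, ∑ j ∈ Finset.range n,
          (if k i = k j then 0 else ‖lp.entry T (k i) (k j)‖)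
        ≤ ∑ i ∈ Finset.range n, ∑ j ∈ Finset.range n,
            ε * ((1 / 2) ^ (i + 1) * (1 / 2) ^ (j + 1)) := by
          refine Finset.sum_le_sum fun i _ => Finset.sum_le_sum fun j _ => ?_
          split_ifs with hij
          · positivity
          · exact hoff i j fun h => hij (congrArg k h)
      _ = ε * ((∑ i ∈ Finset.range n, (1 / 2 : ℝ) ^ (i + 1)) *
            ∑ j ∈ Finset.range n, (1 / 2 : ℝ) ^ (j + 1)) := by
          simp only [← Finset.mul_sum, ← Finset.sum_mul]
      _ ≤ ε * (1 * 1) := by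
          gcongr
          · exact hgeom n
          · exact hgeom n
      _ ≤ 2 * ε := by linarith
  refine lp.norm_le_of_tendsto (l := atTop)
    (F := fun n => ∑ i ∈ (Finset.range n).image k, lp.single p i
      (T (∑ j ∈ (Finset.range n).image k, lp.single p j (x j)) i))
    (Eventually.of_forall fun n => ?_) ?_
  · refine (lp.norm_finite_block_le hp T hε.le _
      (fun i _ => lp.norm_entry_self_le T hε.le i (hT i)) (hsum n) x).trans_eq (by ring)
  · have hlim := (T.continuous.tendsto _).comp
      (lp.tendsto_sum_single_of_proj hptop hk x (P x) (hP x))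
    refine tendsto_pi_nhds.2 fun l => ?_
    have hl := ((lp.evalCLM ℂ E p l).continuous.tendsto _).comp hlim
    change Tendsto _ _ (𝓝 (P (T (P x)) l))
    rw [hP]
    simp only [id, lp.coeFn_sum, Finset.sum_apply, lp.coeFn_single, Finset.sum_pi_single]
    split_ifs with h
    · obtain ⟨m, rfl⟩ := h
      refine hl.congr' ?_
      filter_upwards [eventually_gt_atTop m] with n hn
      rw [if_pos (Finset.mem_image_of_mem k (Finset.mem_range.2 hn))]
      rfl
    · refine tendsto_const_nhds.congr fun n => ?_
      rw [if_neg fun hmem => h ?_]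
      obtain ⟨m, -, rfl⟩ := Finset.mem_image.1 hmem
      exact ⟨m, rfl⟩
end
end

section
/- Let 1 < p, q < ∞ and let X = ℓ_p(ℓ_q^n) over the complex scalars. Let 𝓙 ⊆ 𝓛(X) be a two-sided ideal of the ring 𝓛(X) that contains a noncompact operator. Then every operator T ∈ 𝓛(X) that factors through ℓ_p belongs to 𝓙; that is, whenever T = T₂ ∘ T₁ with bounded linear operators T₁ : X → ℓ_p and T₂ : ℓ_p → X, one has T ∈ 𝓙. -/
open scoped ENNReal NNReal

noncomputable section

namespace lp

open Filter Topology

variable {p : ℝ≥0∞} [Fact (1 ≤ p)] {E : ℕ → Type*} [∀ n, NormedAddCommGroup (E n)]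
  [∀ n, NormedSpace ℂ (E n)]

/-- The coordinate projection of `lp E p` onto a finite set of coordinates. -/
def cutoff (p : ℝ≥0∞) [Fact (1 ≤ p)] (E : ℕ → Type*) [∀ n, NormedAddCommGroup (E n)]
    [∀ n, NormedSpace ℂ (E n)] (F : Finset ℕ) : lp E p →L[ℂ] lp E p :=
  ∑ n ∈ F, singleContinuousLinearMap ℂ E p n ∘L evalCLM ℂ E p n

theorem toReal_pos_of_ne_top (hp : p ≠ ∞) : 0 < p.toReal :=
  ENNReal.toReal_pos (zero_lt_one.trans_le Fact.out).ne' hp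

theorem cutoff_apply (F : Finset ℕ) (x : lp E p) :
    cutoff p E F x = ∑ n ∈ F, lp.single p n (x n) := by
  simp [cutoff, evalCLM]

theorem cutoff_apply_apply (F : Finset ℕ) (x : lp E p) (n : ℕ) :
    cutoff p E F x n = if n ∈ F then x n else 0 := by
  rw [cutoff_apply, coeFn_sum, Finset.sum_apply]
  simp only [lp.coeFn_single, Finset.sum_pi_single]

theorem norm_cutoff_rpow (hp : p ≠ ∞) (F : Finset ℕ) (x : lp E p) :
    ‖cutoff p E F x‖ ^ p.toReal = ∑ n ∈ F, ‖x n‖ ^ p.toReal := by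
  rw [cutoff_apply, lp.norm_sum_single (toReal_pos_of_ne_top hp)]

theorem norm_cutoff_le (hp : p ≠ ∞) (F : Finset ℕ) (x : lp E p) : ‖cutoff p E F x‖ ≤ ‖x‖ := by
  have h0 := toReal_pos_of_ne_top hp
  rw [← Real.rpow_le_rpow_iff (norm_nonneg _) (norm_nonneg _) h0, norm_cutoff_rpow hp]
  exact sum_rpow_le_norm_rpow h0 x F

theorem norm_sub_cutoff_le (hp : p ≠ ∞) (F : Finset ℕ) (x : lp E p) :
    ‖x - cutoff p E F x‖ ≤ ‖x‖ := by
  have h0 := toReal_pos_of_ne_top hp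
  rw [← Real.rpow_le_rpow_iff (norm_nonneg _) (norm_nonneg _) h0, cutoff_apply,
    lp.norm_compl_sum_single h0]
  exact sub_le_self _ (Finset.sum_nonneg fun _ _ => by positivity)

theorem cutoff_cutoff_of_disjoint {F G : Finset ℕ} (h : Disjoint F G) (x : lp E p) :
    cutoff p E F (cutoff p E G x) = 0 := by
  ext n
  rw [cutoff_apply_apply, cutoff_apply_apply]
  by_cases hF : n ∈ F
  · simp [hF, Finset.disjoint_left.1 h hF]
  · simp [hF]

theorem tendsto_cutoff_range (hp : p ≠ ∞) (x : lp E p) :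
    Tendsto (fun N => cutoff p E (Finset.range N) x) atTop (𝓝 x) := by
  simp only [cutoff_apply]
  exact (lp.hasSum_single hp x).tendsto_sum_nat

theorem isCompactOperator_cutoff [∀ n, FiniteDimensional ℂ (E n)] (F : Finset ℕ) :
    IsCompactOperator (cutoff p E F) := by
  have h : cutoff p E F ∈ compactOperator (RingHom.id ℂ) (lp E p) (lp E p) := by
    refine Submodule.sum_mem _ fun n _ => ?_
    have := FiniteDimensional.proper ℂ (E n)
    exact (isCompactOperator_of_locallyCompactSpace_rng
      (singleContinuousLinearMap ℂ E p n)).comp_clm (evalCLM ℂ E p n)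
  exact h

/-- A noncompact operator is bounded below on normalized vectors supported arbitrarily far out. -/
theorem exists_tail_of_not_isCompactOperator [∀ n, FiniteDimensional ℂ (E n)] (hp : p ≠ ∞)
    {Y : Type*} [NormedAddCommGroup Y] [NormedSpace ℂ Y] [CompleteSpace Y]
    (S : lp E p →L[ℂ] Y) (hS : ¬ IsCompactOperator S) :
    ∃ δ > 0, ∀ N : ℕ, ∃ x : lp E p, ‖x‖ ≤ 1 ∧ (∀ n < N, x n = 0) ∧ δ < ‖S x‖ := by
  by_contra! H
  refine hS (isCompactOperator_of_tendsto (l := atTop)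
    (F := fun N => S ∘L cutoff p E (Finset.range N)) ?_
    (.of_forall fun N => (isCompactOperator_cutoff _).clm_comp S))
  rw [Metric.tendsto_atTop]
  intro ε hε
  obtain ⟨N, hN⟩ := H (ε / 2) (half_pos hε)
  refine ⟨N, fun M hM => ?_⟩
  rw [dist_comm, dist_eq_norm]
  refine (ContinuousLinearMap.opNorm_le_of_unit_norm (half_pos hε).le fun x hx => ?_).trans_lt
    (half_lt_self hε)
  have := hN (x - cutoff p E (Finset.range M) x) ((norm_sub_cutoff_le hp _ x).trans hx.le)
    fun n hn => by
      rw [coeFn_sub, Pi.sub_apply, cutoff_apply_apply,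
        if_pos (Finset.mem_range.2 (hn.trans_le hM)), sub_self]
  simpa using this

/-- A noncompact operator is bounded below on some normalized block sequence. -/
theorem exists_block_sequence [∀ n, FiniteDimensional ℂ (E n)] (hp : p ≠ ∞)
    {Y : Type*} [NormedAddCommGroup Y] [NormedSpace ℂ Y] [CompleteSpace Y]
    (S : lp E p →L[ℂ] Y) (hS : ¬ IsCompactOperator S) :
    ∃ δ > 0, ∃ (F : ℕ → Finset ℕ) (x : ℕ → lp E p), Pairwise (Function.onFun Disjoint F) ∧
      ∀ k, ‖x k‖ ≤ 1 ∧ (∀ n ∉ F k, x k n = 0) ∧ δ < ‖S (x k)‖ := by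
  obtain ⟨δ, hδ, H⟩ := exists_tail_of_not_isCompactOperator hp S hS
  refine ⟨δ, hδ, ?_⟩
  let r : Finset ℕ × lp E p → Finset ℕ × lp E p → Prop := fun a b => Disjoint a.1 b.1
  have : Std.Symm r := ⟨fun _ _ h => Disjoint.symm h⟩
  suffices h : ∃ f : ℕ → Finset ℕ × lp E p,
      (∀ k, ‖(f k).2‖ ≤ 1 ∧ (∀ n ∉ (f k).1, (f k).2 n = 0) ∧ δ < ‖S (f k).2‖) ∧
        Pairwise (Function.onFun r f) by
    obtain ⟨f, hf, hr⟩ := h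
    exact ⟨fun k => (f k).1, fun k => (f k).2, hr, hf⟩
  refine exists_seq_of_forall_finset_exists'
    (fun a : Finset ℕ × lp E p => ‖a.2‖ ≤ 1 ∧ (∀ n ∉ a.1, a.2 n = 0) ∧ δ < ‖S a.2‖) r
    fun s _ => ?_
  obtain ⟨N, hN⟩ := (s.sup Prod.fst).exists_nat_subset_range
  obtain ⟨x, hx1, hx0, hxS⟩ := H N
  have ht : Tendsto (fun M => ‖S (cutoff p E (Finset.range M) x)‖) atTop (𝓝 ‖S x‖) :=
    ((S.continuous.tendsto x).comp (tendsto_cutoff_range hp x)).norm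
  obtain ⟨M, hM⟩ := (ht.eventually (lt_mem_nhds hxS)).exists
  refine ⟨(Finset.Ico N M, cutoff p E (Finset.range M) x),
    ⟨(norm_cutoff_le hp _ x).trans hx1, fun n hn => ?_, hM⟩, fun a ha => ?_⟩
  · rw [cutoff_apply_apply]
    split_ifs with h
    · exact hx0 n (by simp at h hn; omega)
    · rfl
  · refine Finset.disjoint_left.2 fun n hn hn' => ?_
    have := hN (Finset.le_sup (f := Prod.fst) ha hn)
    simp at this hn'
    omega

/-- Normalized vectors with disjoint supports are the images of the unit vectors of `ℓ_p` under a
bounded operator. -/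
theorem exists_map_single_eq (hp : p ≠ ∞) {F : ℕ → Finset ℕ}
    (hF : Pairwise (Function.onFun Disjoint F)) {x : ℕ → lp E p} (hx1 : ∀ k, ‖x k‖ ≤ 1)
    (hx0 : ∀ k, ∀ n ∉ F k, x k n = 0) :
    ∃ J : lp (fun _ : ℕ => ℂ) p →L[ℂ] lp E p, ∀ k, J (lp.single p k 1) = x k := by
  classical
  have h0 := toReal_pos_of_ne_top hp
  obtain ⟨s, hs⟩ : ∃ s : ℕ → ℕ, ∀ k, ∀ n ∈ F k, s n = k := by
    refine ⟨fun n => if h : ∃ k, n ∈ F k then h.choose else 0, fun k n hn => ?_⟩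
    have h : ∃ k, n ∈ F k := ⟨k, hn⟩
    simp only [dif_pos h]
    by_contra hne
    exact Finset.disjoint_left.1 (hF hne) h.choose_spec hn
  have key : ∀ (a : lp (fun _ : ℕ => ℂ) p) (G : Finset ℕ),
      ∑ n ∈ G, ‖a (s n) • x (s n) n‖ ^ p.toReal ≤ ‖a‖ ^ p.toReal := by
    intro a G
    rw [← Finset.sum_fiberwise_of_maps_to (t := G.image s)
      (fun n hn => Finset.mem_image_of_mem s hn)]
    refine le_trans (Finset.sum_le_sum fun k _ => ?_) (sum_rpow_le_norm_rpow h0 a (G.image s))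
    calc ∑ n ∈ G with s n = k, ‖a (s n) • x (s n) n‖ ^ p.toReal
        = ‖a k‖ ^ p.toReal * ∑ n ∈ G with s n = k, ‖x k n‖ ^ p.toReal := by
          rw [Finset.mul_sum]
          refine Finset.sum_congr rfl fun n hn => ?_
          rw [(Finset.mem_filter.1 hn).2, norm_smul,
            Real.mul_rpow (norm_nonneg _) (norm_nonneg _)]
      _ ≤ ‖a k‖ ^ p.toReal * 1 := by
          gcongr
          exact (sum_rpow_le_norm_rpow h0 (x k) _).trans
            (Real.rpow_le_one (norm_nonneg _) (hx1 k) h0.le)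
      _ = ‖a k‖ ^ p.toReal := mul_one _
  let J : lp (fun _ : ℕ => ℂ) p →ₗ[ℂ] lp E p :=
    { toFun := fun a => ⟨fun n => a (s n) • x (s n) n, memℓp_gen' (key a)⟩
      map_add' := fun a b => by ext n; exact add_smul (a (s n)) (b (s n)) (x (s n) n)
      map_smul' := fun c a => by ext n; exact smul_assoc c (a (s n)) (x (s n) n) }
  refine ⟨J.mkContinuous 1 fun a => ?_, fun k => ?_⟩
  · rw [one_mul]
    exact norm_le_of_forall_sum_le h0 (norm_nonneg a) (key a)
  · ext n
    change (lp.single p k (1 : ℂ) : lp (fun _ : ℕ => ℂ) p) (s n) • x (s n) n = x k n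
    by_cases h : s n = k
    · rw [h, lp.single_apply_self, one_smul]
    · rw [lp.single_apply_ne _ _ _ h, zero_smul, hx0 k n fun hn => h (hs k n hn)]

/-- Uniformly bounded functionals depending on disjoint blocks of coordinates define a bounded
operator into `ℓ_p`. -/
theorem exists_map_apply_eq (hp : p ≠ ∞) {F : ℕ → Finset ℕ}
    (hF : Pairwise (Function.onFun Disjoint F)) {C : ℝ} (hC : 0 ≤ C)
    (g : ℕ → lp E p →L[ℂ] ℂ) (hg : ∀ j x, ‖g j x‖ ≤ C * ‖cutoff p E (F j) x‖) :
    ∃ B : lp E p →L[ℂ] lp (fun _ : ℕ => ℂ) p,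
      (∀ x j, B x j = g j x) ∧ ∀ x, ‖B x‖ ≤ C * ‖x‖ := by
  classical
  have h0 := toReal_pos_of_ne_top hp
  have key : ∀ (x : lp E p) (G : Finset ℕ),
      ∑ j ∈ G, ‖g j x‖ ^ p.toReal ≤ (C * ‖x‖) ^ p.toReal := by
    intro x G
    calc ∑ j ∈ G, ‖g j x‖ ^ p.toReal
        ≤ ∑ j ∈ G, C ^ p.toReal * ∑ n ∈ F j, ‖x n‖ ^ p.toReal := by
          refine Finset.sum_le_sum fun j _ => ?_
          rw [← norm_cutoff_rpow hp, ← Real.mul_rpow hC (norm_nonneg _)]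
          exact Real.rpow_le_rpow (norm_nonneg _) (hg j x) h0.le
      _ = C ^ p.toReal * ∑ n ∈ G.biUnion F, ‖x n‖ ^ p.toReal := by
          rw [← Finset.mul_sum, Finset.sum_biUnion fun i _ j _ hij => hF hij]
      _ ≤ (C * ‖x‖) ^ p.toReal := by
          rw [Real.mul_rpow hC (norm_nonneg _)]
          gcongr
          exact sum_rpow_le_norm_rpow h0 x _
  let B : lp E p →ₗ[ℂ] lp (fun _ : ℕ => ℂ) p :=
    { toFun := fun x => ⟨fun j => g j x, memℓp_gen' (key x)⟩
      map_add' := fun x y => by ext j; exact map_add (g j) x y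
      map_smul' := fun c x => by ext j; exact map_smul (g j) c x }
  have hB : ∀ x, ‖B x‖ ≤ C * ‖x‖ := fun x =>
    norm_le_of_forall_sum_le h0 (by positivity) (key x)
  exact ⟨B.mkContinuous C hB, fun _ _ => rfl, hB⟩

/-- For `1 < p < ∞` the unit vectors of `ℓ_p` converge weakly to zero. -/
theorem tendsto_apply_single (hp1 : 1 < p) (hp : p ≠ ∞)
    (f : lp (fun _ : ℕ => ℂ) p →L[ℂ] ℂ) :
    Tendsto (fun k => f (lp.single p k 1)) atTop (𝓝 0) := by
  have h0 := toReal_pos_of_ne_top hp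
  have h1 : 1 < p.toReal := by
    simpa using (ENNReal.toReal_lt_toReal ENNReal.one_ne_top hp).2 hp1
  by_contra H
  obtain ⟨ε, hε, hinf⟩ : ∃ ε > 0, {k | ε ≤ ‖f (lp.single p k 1)‖}.Infinite := by
    rw [Metric.tendsto_atTop] at H
    push Not at H
    obtain ⟨ε, hε, H⟩ := H
    refine ⟨ε, hε, Set.infinite_of_forall_exists_gt fun N => ?_⟩
    obtain ⟨n, hn, h⟩ := H (N + 1)
    exact ⟨n, by simpa using h, hn⟩
  have key : ∀ m : ℕ, (m : ℝ) * ((m : ℝ) ^ (p.toReal - 1) * ε ^ p.toReal)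
      ≤ m * ‖f‖ ^ p.toReal := by
    intro m
    obtain ⟨s, hs, hcard⟩ := hinf.exists_subset_card_eq m
    have hc : ∀ k, ∃ c : ℂ, ‖c‖ = 1 ∧ c * f (lp.single p k 1) = ‖f (lp.single p k 1)‖ := by
      intro k
      obtain ⟨c, hc, h⟩ := RCLike.exists_norm_eq_mul_self (f (lp.single p k 1))
      exact ⟨c, hc, h.symm⟩
    choose c hc1 hc using hc
    set v : lp (fun _ : ℕ => ℂ) p := ∑ k ∈ s, lp.single p k (c k) with hv
    have hvn : ‖v‖ ^ p.toReal = m := by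
      rw [hv, lp.norm_sum_single h0]
      simp [hc1, hcard]
    have hfv : f v = ((∑ k ∈ s, ‖f (lp.single p k 1)‖ : ℝ) : ℂ) := by
      rw [hv, map_sum, Complex.ofReal_sum]
      refine Finset.sum_congr rfl fun k _ => ?_
      rw [← hc k, ← smul_eq_mul, ← map_smul, ← lp.single_smul, smul_eq_mul, mul_one]
    have hle : m * ε ≤ ‖f‖ * ‖v‖ := by
      refine le_trans ?_ (f.le_opNorm v)
      rw [hfv, Complex.norm_real]
      refine le_trans ?_ (le_abs_self _)
      rw [← hcard, ← nsmul_eq_mul]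
      exact Finset.card_nsmul_le_sum _ _ _ fun k hk => hs hk
    have := Real.rpow_le_rpow (by positivity) hle h0.le
    rw [Real.mul_rpow (by positivity) hε.le, Real.mul_rpow (by positivity) (by positivity),
      hvn] at this
    rcases Nat.eq_zero_or_pos m with rfl | hm
    · simp
    · have hm' : (0 : ℝ) < m := by exact_mod_cast hm
      rw [← mul_assoc, Real.rpow_sub_one hm'.ne', mul_div_cancel₀ _ hm'.ne']
      linarith
  have ht : Tendsto (fun m : ℕ => (m : ℝ) ^ (p.toReal - 1) * ε ^ p.toReal) atTop atTop :=
    ((tendsto_rpow_atTop (sub_pos.2 h1)).comp tendsto_natCast_atTop_atTop).atTop_mul_const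
      (by positivity)
  obtain ⟨m, hm, hm0⟩ :=
    ((ht.eventually_gt_atTop (‖f‖ ^ p.toReal)).and (eventually_gt_atTop 0)).exists
  have hm' : (0 : ℝ) < m := by exact_mod_cast hm0
  exact absurd (le_of_mul_le_mul_left (key m) hm') (not_le.2 hm)

/-- For `1 < p < ∞`, an operator from `ℓ_p` to a finite-dimensional space maps the unit vectors to
a null sequence. -/
theorem tendsto_map_single_of_finiteDimensional (hp1 : 1 < p) (hp : p ≠ ∞) {Y : Type*}
    [NormedAddCommGroup Y] [NormedSpace ℂ Y] [FiniteDimensional ℂ Y]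
    (f : lp (fun _ : ℕ => ℂ) p →L[ℂ] Y) :
    Tendsto (fun k => f (lp.single p k 1)) atTop (𝓝 0) := by
  let e := (Module.finBasis ℂ Y).equivFunL
  have h : Tendsto (fun k => e (f (lp.single p k 1))) atTop (𝓝 0) := by
    refine tendsto_pi_nhds.2 fun i => ?_
    exact tendsto_apply_single hp1 hp
      ((ContinuousLinearMap.proj i : (Fin (Module.finrank ℂ Y) → ℂ) →L[ℂ] ℂ) ∘L
        e.toContinuousLinearMap ∘L f)
  simpa [Function.comp_def] using (e.symm.continuous.tendsto 0).comp h

theorem tendsto_cutoff_map_single [∀ n, FiniteDimensional ℂ (E n)] (hp1 : 1 < p) (hp : p ≠ ∞)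
    (U : lp (fun _ : ℕ => ℂ) p →L[ℂ] lp E p) (F : Finset ℕ) :
    Tendsto (fun k => cutoff p E F (U (lp.single p k 1))) atTop (𝓝 0) := by
  simp only [cutoff_apply]
  rw [← Finset.sum_const_zero (s := F)]
  refine tendsto_finsetSum _ fun n _ => ?_
  have := tendsto_map_single_of_finiteDimensional hp1 hp (evalCLM ℂ E p n ∘L U)
  simpa [Function.comp_def, evalCLM] using
    ((singleContinuousLinearMap ℂ E p n).continuous.tendsto 0).comp this

/-- An operator on `ℓ_p` is bounded by the sum of the norms of the images of the unit vectors. -/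
theorem norm_le_of_norm_map_single_le (hp : p ≠ ∞) {Y : Type*} [NormedAddCommGroup Y]
    [NormedSpace ℂ Y] (K : lp (fun _ : ℕ => ℂ) p →L[ℂ] Y) {c : ℕ → ℝ} (hc : Summable c)
    (hK : ∀ i, ‖K (lp.single p i 1)‖ ≤ c i) : ‖K‖ ≤ ∑' i, c i := by
  have hc0 : ∀ i, 0 ≤ c i := fun i => (norm_nonneg _).trans (hK i)
  refine K.opNorm_le_bound (tsum_nonneg hc0) fun a => ?_
  have h : HasSum (fun i => K (lp.single p i (a i))) (K a) :=
    (lp.hasSum_single hp a).mapL K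
  rw [← h.tsum_eq]
  refine tsum_of_norm_bounded (hc.hasSum.mul_right ‖a‖) fun i => ?_
  have : lp.single p i (a i) = a i • (lp.single p i 1 : lp (fun _ : ℕ => ℂ) p) := by
    rw [← lp.single_smul, smul_eq_mul, mul_one]
  rw [this, map_smul, norm_smul, mul_comm]
  exact mul_le_mul (hK i) (norm_apply_le_norm (zero_lt_one.trans_le Fact.out).ne' a i)
    (norm_nonneg _) (hc0 i)

/-- For `1 < p < ∞`, some subsequence of the images of the unit vectors of `ℓ_p` is, up to a
summable error, a sequence of vectors with disjoint finite supports. -/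
theorem exists_subsequence_near_blocks [∀ n, FiniteDimensional ℂ (E n)] (hp1 : 1 < p)
    (hp : p ≠ ∞) (U : lp (fun _ : ℕ => ℂ) p →L[ℂ] lp E p) {ε : ℝ} (hε : 0 < ε) :
    ∃ (t k : ℕ → ℕ) (F : ℕ → Finset ℕ), t.Injective ∧ k.Injective ∧
      Pairwise (Function.onFun Disjoint F) ∧
      ∀ i, ‖U (lp.single p (k i) 1) - cutoff p E (F i) (U (lp.single p (k i) 1))‖
        ≤ ε * (1 / 2) ^ t i := by
  let r : ℕ × ℕ × Finset ℕ → ℕ × ℕ × Finset ℕ → Prop := fun a b =>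
    a.1 ≠ b.1 ∧ a.2.1 ≠ b.2.1 ∧ Disjoint a.2.2 b.2.2
  have : Std.Symm r := ⟨fun _ _ h => ⟨h.1.symm, h.2.1.symm, h.2.2.symm⟩⟩
  suffices h : ∃ f : ℕ → ℕ × ℕ × Finset ℕ,
      (∀ i, ‖U (lp.single p (f i).2.1 1) - cutoff p E (f i).2.2 (U (lp.single p (f i).2.1 1))‖
        ≤ ε * (1 / 2) ^ (f i).1) ∧ Pairwise (Function.onFun r f) by
    obtain ⟨f, hf, hr⟩ := h
    exact ⟨fun i => (f i).1, fun i => (f i).2.1, fun i => (f i).2.2,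
      fun i j h => by_contra fun hne => (hr hne).1 h,
      fun i j h => by_contra fun hne => (hr hne).2.1 h, fun i j h => (hr h).2.2, hf⟩
  refine exists_seq_of_forall_finset_exists'
    (fun a : ℕ × ℕ × Finset ℕ =>
      ‖U (lp.single p a.2.1 1) - cutoff p E a.2.2 (U (lp.single p a.2.1 1))‖
        ≤ ε * (1 / 2) ^ a.1) r fun s _ => ?_
  obtain ⟨t, ht⟩ := Infinite.exists_notMem_finset (s.image Prod.fst)
  obtain ⟨N, hN⟩ := (s.sup fun a => a.2.2).exists_nat_subset_range
  have hη : 0 < ε * (1 / 2) ^ t / 2 := by positivity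
  have h1 := (tendsto_cutoff_map_single hp1 hp U (Finset.range N)).norm.eventually
    (gt_mem_nhds (norm_zero.trans_lt hη))
  obtain ⟨k, hk, hks⟩ := (h1.and (eventually_gt_atTop (s.sup fun a => a.2.1))).exists
  set u := U (lp.single p k 1)
  have h2 := (tendsto_cutoff_range hp u).eventually (Metric.ball_mem_nhds u hη)
  obtain ⟨M, hM, hNM⟩ := (h2.and (eventually_ge_atTop N)).exists
  refine ⟨(t, k, Finset.Ico N M), ?_, fun a ha => ⟨?_, ?_, ?_⟩⟩
  · have hsplit : u - cutoff p E (Finset.Ico N M) u =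
        (u - cutoff p E (Finset.range M) u) + cutoff p E (Finset.range N) u := by
      simp only [cutoff_apply]
      rw [← Finset.sum_range_add_sum_Ico _ hNM]
      abel
    change ‖u - cutoff p E (Finset.Ico N M) u‖ ≤ _
    rw [hsplit]
    refine (norm_add_le _ _).trans ?_
    rw [dist_comm, dist_eq_norm] at hM
    change _ ≤ ε * (1 / 2) ^ t
    linarith
  · rintro rfl
    exact ht (Finset.mem_image_of_mem _ ha)
  · exact ((Finset.le_sup (f := fun a : ℕ × ℕ × Finset ℕ => a.2.1) ha).trans_lt hks).ne
  · refine Finset.disjoint_left.2 fun n hn hn' => ?_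
    have := hN (Finset.le_sup (f := fun a : ℕ × ℕ × Finset ℕ => a.2.2) ha hn)
    simp at this hn'
    omega

/-- If the images of the unit vectors of `ℓ_p` are bounded below, the identity of `ℓ_p` factors
through the operator. -/
theorem exists_comp_eq_id_of_lt_norm_map_single [∀ n, FiniteDimensional ℂ (E n)] (hp1 : 1 < p)
    (hp : p ≠ ∞) (U : lp (fun _ : ℕ => ℂ) p →L[ℂ] lp E p) {δ : ℝ} (hδ : 0 < δ)
    (hU : ∀ k, δ < ‖U (lp.single p k 1)‖) :
    ∃ (A : lp (fun _ : ℕ => ℂ) p →L[ℂ] lp (fun _ : ℕ => ℂ) p)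
      (B : lp E p →L[ℂ] lp (fun _ : ℕ => ℂ) p), B ∘L U ∘L A = .id ℂ _ := by
  obtain ⟨t, k, F, ht, hk, hF, hz⟩ :=
    exists_subsequence_near_blocks hp1 hp U (ε := δ / 8) (by positivity)
  have hp0 : 0 < p := zero_lt_one.trans_le Fact.out
  obtain ⟨A, hA⟩ := exists_map_single_eq (E := fun _ => ℂ) hp (F := fun i => {k i})
    (fun i j hij => by simpa using hk.ne hij) (x := fun i => lp.single p (k i) 1)
    (fun i => by rw [lp.norm_single hp0, norm_one])
    fun i n hn => lp.single_apply_ne _ _ _ (by simpa using hn)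
  set u : ℕ → lp E p := fun i => U (lp.single p (k i) 1) with hu
  set y : ℕ → lp E p := fun i => cutoff p E (F i) (u i) with hy
  have hyn : ∀ i, δ / 2 ≤ ‖y i‖ := by
    intro i
    have h1 : δ < ‖u i‖ := hU (k i)
    have h2 : ‖u i - y i‖ ≤ δ / 8 := (hz i).trans
      (mul_le_of_le_one_right (by positivity) (pow_le_one₀ (by norm_num) (by norm_num)))
    have h3 := norm_sub_norm_le (u i) (y i)
    linarith
  have hy0 : ∀ i, 0 < ‖y i‖ := fun i => (half_pos hδ).trans_le (hyn i)
  have hdual : ∀ i, ∃ g : lp E p →L[ℂ] ℂ, ‖g‖ = 1 ∧ g (y i) = ‖y i‖ := fun i =>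
    exists_dual_vector ℂ (y i) (hy0 i).ne'
  choose h hh1 hh using hdual
  obtain ⟨B, hB, hBn⟩ := exists_map_apply_eq hp hF (C := 2 / δ) (by positivity)
    (fun i => ((‖y i‖ : ℂ)⁻¹) • (h i ∘L cutoff p E (F i))) fun i x => by
      have h1 : ‖h i (cutoff p E (F i) x)‖ ≤ ‖cutoff p E (F i) x‖ := by
        simpa [hh1 i] using (h i).le_opNorm (cutoff p E (F i) x)
      have h2 : ‖y i‖⁻¹ ≤ 2 / δ := by
        rw [← inv_div]
        exact inv_anti₀ (half_pos hδ) (hyn i)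
      simpa [norm_smul] using mul_le_mul h2 h1 (norm_nonneg _) (by positivity)
  have hcut : ∀ i, cutoff p E (F i) (y i) = y i := by
    intro i
    ext n
    simp only [hy, cutoff_apply_apply]
    split_ifs <;> rfl
  have hBy : ∀ i, B (y i) = lp.single p i 1 := by
    intro i
    ext j
    rw [hB]
    rcases eq_or_ne j i with rfl | hij
    · have : (‖y j‖ : ℂ) ≠ 0 := by exact_mod_cast (hy0 j).ne'
      rw [lp.single_apply_self]
      simp [hcut, hh, this]
    · rw [lp.single_apply_ne _ _ _ hij]
      simp [hy, cutoff_cutoff_of_disjoint (hF hij)]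
  set V : lp (fun _ : ℕ => ℂ) p →L[ℂ] lp (fun _ : ℕ => ℂ) p := B ∘L U ∘L A with hV
  have hsum : Summable fun i => (1 / 4 : ℝ) * (1 / 2) ^ t i :=
    (summable_geometric_two.comp_injective ht).mul_left _
  have hle : ∑' i, (1 / 4 : ℝ) * (1 / 2) ^ t i ≤ 1 / 2 := by
    rw [tsum_mul_left]
    have := tsum_comp_le_tsum_of_inj summable_geometric_two (fun _ => by positivity) ht
    rw [tsum_geometric_two] at this
    simp only [Function.comp_def] at this
    linarith
  have hV1 : ‖V - 1‖ < 1 := by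
    refine ((norm_le_of_norm_map_single_le hp _ hsum fun i => ?_).trans hle).trans_lt
      (by norm_num)
    have : (V - 1) (lp.single p i 1) = B (u i - y i) := by
      rw [map_sub, hBy]
      simp [hV, hA, hu]
    rw [this]
    refine (hBn _).trans ?_
    calc 2 / δ * ‖u i - y i‖ ≤ 2 / δ * (δ / 8 * (1 / 2) ^ t i) := by
          gcongr
          exact hz i
      _ = 1 / 4 * (1 / 2) ^ t i := by field_simp; norm_num
  obtain ⟨W, hW⟩ : IsUnit V := by
    have := (Units.oneSub (1 - V) (by rwa [norm_sub_rev])).isUnit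
    simpa using this
  refine ⟨A, (↑W⁻¹ : lp (fun _ : ℕ => ℂ) p →L[ℂ] lp (fun _ : ℕ => ℂ) p) ∘L B, ?_⟩
  rw [ContinuousLinearMap.comp_assoc, ← hV, ← hW]
  exact W.inv_mul

/-- The identity of `ℓ_p` factors through every noncompact operator on an `ℓ_p`-sum of
finite-dimensional spaces, `1 < p < ∞`. -/
theorem exists_comp_eq_id_of_not_isCompactOperator [∀ n, FiniteDimensional ℂ (E n)]
    (hp1 : 1 < p) (hp : p ≠ ∞) (S : lp E p →L[ℂ] lp E p) (hS : ¬ IsCompactOperator S) :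
    ∃ (A : lp (fun _ : ℕ => ℂ) p →L[ℂ] lp E p) (B : lp E p →L[ℂ] lp (fun _ : ℕ => ℂ) p),
      B ∘L S ∘L A = .id ℂ _ := by
  have : ∀ n, CompleteSpace (E n) := fun n => FiniteDimensional.complete ℂ (E n)
  obtain ⟨δ, hδ, F, x, hF, hx⟩ := exists_block_sequence hp S hS
  obtain ⟨J, hJ⟩ := exists_map_single_eq hp hF (fun k => (hx k).1) fun k => (hx k).2.1
  obtain ⟨A, B, h⟩ := exists_comp_eq_id_of_lt_norm_map_single hp1 hp (S ∘L J) hδ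
    fun k => by simpa [hJ] using (hx k).2.2
  exact ⟨J ∘L A, B, h⟩

end lp

set_option synthInstance.maxHeartbeats 1000000 in
set_option maxHeartbeats 2000000 in
/-- Let `X = ℓ_p(ℓ_q^n)`, `1 < p, q < ∞`, over the complex scalars, and let `𝓙 ⊆ 𝓛(X)` be a
two-sided ideal containing a noncompact operator.  Then every operator `T ∈ 𝓛(X)` factoring
through `ℓ_p` belongs to `𝓙`. -/
theorem lp_factorable_mem_ideal
    (p q : ℝ≥0∞) [Fact (1 ≤ p)] [Fact (1 ≤ q)]
    (hp1 : 1 < p) (hptop : p ≠ ∞) (hq1 : 1 < q) (hqtop : q ≠ ∞)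
    (𝓙 : TwoSidedIdeal
      (lp (fun n : ℕ => PiLp q (fun _ : Fin (n + 1) => ℂ)) p →L[ℂ]
        lp (fun n : ℕ => PiLp q (fun _ : Fin (n + 1) => ℂ)) p))
    (S : lp (fun n : ℕ => PiLp q (fun _ : Fin (n + 1) => ℂ)) p →L[ℂ]
      lp (fun n : ℕ => PiLp q (fun _ : Fin (n + 1) => ℂ)) p)
    (hS : S ∈ 𝓙) (hSnc : ¬ IsCompactOperator S)
    (T : lp (fun n : ℕ => PiLp q (fun _ : Fin (n + 1) => ℂ)) p →L[ℂ]
      lp (fun n : ℕ => PiLp q (fun _ : Fin (n + 1) => ℂ)) p)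
    (T₁ : lp (fun n : ℕ => PiLp q (fun _ : Fin (n + 1) => ℂ)) p →L[ℂ]
      lp (fun _ : ℕ => ℂ) p)
    (T₂ : lp (fun _ : ℕ => ℂ) p →L[ℂ]
      lp (fun n : ℕ => PiLp q (fun _ : Fin (n + 1) => ℂ)) p)
    (hfact : T = T₂ ∘L T₁) :
    T ∈ 𝓙 := by
  obtain ⟨A, B, hAB⟩ := lp.exists_comp_eq_id_of_not_isCompactOperator hp1 hptop S hSnc
  have hT : T = (T₂ ∘L B) * S * (A ∘L T₁) := by
    ext1 x
    have := DFunLike.congr_fun hAB (T₁ x)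
    simp only [ContinuousLinearMap.comp_apply, ContinuousLinearMap.id_apply] at this
    simp [hfact, this]
  rw [hT]
  exact 𝓙.mul_mem_right _ _ (𝓙.mul_mem_left _ _ hS)
end
end
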